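/- The following formulas are Ł²_Δ valid (i.e., receive value (1,0) under every pair of valuations): ¬∼¬α ↔ ¬¬∼α; ¬∼∼α ↔ ∼¬∼α; ¬∼Δα ↔ Δ¬∼α; ¬∼(α→α') ↔ (¬∼α → ¬∼α'), for all formulas α, α' of L_Ł²Δ. -/

import Mathlib

/-- The language L_Ł²Δ: α ::= p | ¬α | ∼α | Δα | (α→α). -/
inductive L2 : Type where
  | var  : ℕ → L2
  | neg  : L2 → L2
  | snot : L2 → L2
  | delta : L2 → L2
  | imp  : L2 → L2 → L2

open Classical in
mutual
  /-- Support of truth in Ł²Δ. -/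
  noncomputable def val1 (v1 v2 : ℕ → ℝ) : L2 → ℝ
    | .var p => v1 p
    | .neg α => val2 v1 v2 α
    | .snot α => 1 - val1 v1 v2 α
    | .delta α => if val1 v1 v2 α = 1 then 1 else 0
    | .imp α β => min 1 (1 - val1 v1 v2 α + val1 v1 v2 β)
  /-- Support of falsity in Ł²Δ. -/
  noncomputable def val2 (v1 v2 : ℕ → ℝ) : L2 → ℝ
    | .var p => v2 p
    | .neg α => val1 v1 v2 α
    | .snot α => 1 - val2 v1 v2 α
    | .delta α => if val2 v1 v2 α = 0 then 0 else 1
    | .imp α β => max 0 (val2 v1 v2 β - val2 v1 v2 α)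
end

/-- Strong conjunction: α⊙β := ∼(α→∼β). -/
def L2.odot (α β : L2) : L2 := .snot (.imp α (.snot β))

/-- Biconditional: α↔β := (α→β)⊙(β→α). -/
def L2.biimp (α β : L2) : L2 := L2.odot (.imp α β) (.imp β α)

/-- Ł²Δ validity: value (1,0) under every pair of valuations into [0,1]. -/
def L2Valid (α : L2) : Prop :=
  ∀ v1 v2 : ℕ → ℝ, (∀ p, v1 p ∈ Set.Icc (0:ℝ) 1) → (∀ p, v2 p ∈ Set.Icc (0:ℝ) 1) →
    val1 v1 v2 α = 1 ∧ val2 v1 v2 α = 0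

/-- A biconditional is valid as soon as its two sides have the same values. -/
theorem L2Valid.biimp_of_val_eq {α β : L2}
    (h1 : ∀ v1 v2 : ℕ → ℝ, val1 v1 v2 α = val1 v1 v2 β)
    (h2 : ∀ v1 v2 : ℕ → ℝ, val2 v1 v2 α = val2 v1 v2 β) :
    L2Valid (L2.biimp α β) := by
  intro v1 v2 _ _
  simp [L2.biimp, L2.odot, val1, val2, h1 v1 v2, h2 v1 v2]

theorem neg_snot_commutation_valid (α α' : L2) :
    L2Valid (L2.biimp (.neg (.snot (.neg α))) (.neg (.neg (.snot α)))) ∧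
    L2Valid (L2.biimp (.neg (.snot (.snot α))) (.snot (.neg (.snot α)))) ∧
    L2Valid (L2.biimp (.neg (.snot (.delta α))) (.delta (.neg (.snot α)))) ∧
    L2Valid (L2.biimp (.neg (.snot (.imp α α'))) (.imp (.neg (.snot α)) (.neg (.snot α')))) := by
  refine ⟨.biimp_of_val_eq ?_ ?_, .biimp_of_val_eq ?_ ?_, .biimp_of_val_eq ?_ ?_,
    .biimp_of_val_eq ?_ ?_⟩ <;> intro v1 v2 <;> simp only [val1, val2] <;> grind
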